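/- arXiv:1009.2316 — 3 statements merged into one kernel-verified Lean document; each statement's English description precedes it below -/
import Mathlib

section
/- Let n be an even integer with n ≥ 4 and let f : (ℙ(ℝⁿ))^{n+1} → ℝ_ε be a nonzero GL_n(ℝ)-equivariant map. Then the coboundary of f does not vanish everywhere on (ℙ(ℝⁿ))^{n+2}; in fact, with e_1,…,e_n the standard basis, e_0 = e_1+⋯+e_n, one has ∑_{i=0}^{n+1} (−1)^i f applied to the tuple (e_0, e_1, …, e_n, e_1+e_2) with the i-th entry omitted is nonzero. -/
open Matrix

noncomputable section

/-- Sign of the determinant of `g` (the character ε of `GL_n(ℝ)`). -/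
def eps {n : ℕ} (g : GL (Fin n) ℝ) : ℝ :=
  Real.sign ((g : Matrix (Fin n) (Fin n) ℝ).det)

/-- Action of `GL n ℝ` on the projective space of `ℝⁿ`. -/
def glAct {n : ℕ} (g : GL (Fin n) ℝ) (x : Projectivization ℝ (Fin n → ℝ)) :
    Projectivization ℝ (Fin n → ℝ) :=
  Projectivization.map (Matrix.mulVecLin (g : Matrix (Fin n) (Fin n) ℝ))
    (fun a b hab => by
      have hab' : (↑g : Matrix (Fin n) (Fin n) ℝ) *ᵥ a = (↑g : Matrix (Fin n) (Fin n) ℝ) *ᵥ b := hab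
      have key : ((↑g⁻¹ : Matrix (Fin n) (Fin n) ℝ) * (↑g : Matrix (Fin n) (Fin n) ℝ)) = 1 :=
        Units.inv_mul g
      calc a = 1 *ᵥ a := (Matrix.one_mulVec a).symm
        _ = (↑g⁻¹ : Matrix (Fin n) (Fin n) ℝ) *ᵥ ((↑g : Matrix (Fin n) (Fin n) ℝ) *ᵥ a) := by
              rw [Matrix.mulVec_mulVec, key]
        _ = (↑g⁻¹ : Matrix (Fin n) (Fin n) ℝ) *ᵥ ((↑g : Matrix (Fin n) (Fin n) ℝ) *ᵥ b) := by
              rw [hab']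
        _ = 1 *ᵥ b := by rw [Matrix.mulVec_mulVec, key]
        _ = b := Matrix.one_mulVec b) x

/-- `GL_n(ℝ)`-equivariance with values in the sign module `ℝ_ε`:
`f(g·x_1,…,g·x_q) = ε(g)·f(x_1,…,x_q)`. -/
def PEquivariant {n q : ℕ} (f : (Fin q → Projectivization ℝ (Fin n → ℝ)) → ℝ) : Prop :=
  ∀ (g : GL (Fin n) ℝ) (x : Fin q → Projectivization ℝ (Fin n → ℝ)),
    f (fun i => glAct g (x i)) = eps g * f x

lemma ones_ne_zero {n : ℕ} (hn : 0 < n) : (fun _ => (1 : ℝ)) ≠ (0 : Fin n → ℝ) := by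
  intro h
  have := congrFun h ⟨0, hn⟩
  simp at this

lemma single_ne_zero' {n : ℕ} (j : Fin n) : (Pi.single j 1 : Fin n → ℝ) ≠ 0 := by
  intro h
  have := congrFun h j
  simp at this

lemma single_add_single_ne_zero {n : ℕ} (hn : 2 ≤ n) :
    (Pi.single (⟨0, by omega⟩ : Fin n) 1 + Pi.single (⟨1, by omega⟩ : Fin n) 1 :
      Fin n → ℝ) ≠ 0 := by
  intro h
  have := congrFun h ⟨0, by omega⟩
  simp [Pi.single_apply] at this

lemma dotProduct_rep_mk_eq_zero {n : ℕ} {φ v : Fin n → ℝ} (hv : v ≠ 0) (h : φ ⬝ᵥ v = 0) :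
    φ ⬝ᵥ (Projectivization.mk ℝ v hv).rep = 0 := by
  obtain ⟨a, ha⟩ := Projectivization.exists_smul_eq_mk_rep ℝ v hv
  rw [← ha, Units.smul_def, dotProduct_smul, h, smul_zero]

lemma glAct_mk {n : ℕ} (g : GL (Fin n) ℝ) {v w : Fin n → ℝ} (hv : v ≠ 0) (hw : w ≠ 0) (a : ℝ)
    (h : a • w = (g : Matrix (Fin n) (Fin n) ℝ) *ᵥ v) :
    glAct g (Projectivization.mk ℝ v hv) = Projectivization.mk ℝ w hw :=
  (Projectivization.mk_eq_mk_iff' ℝ _ _ _ hw).2 ⟨a, h⟩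

/-- An equivariant map vanishes on tuples fixed by a reflection along `v` with mirror `φ = 0`. -/
lemma PEquivariant.eq_zero_of_reflection {n q : ℕ}
    {f : (Fin q → Projectivization ℝ (Fin n → ℝ)) → ℝ} (hf : PEquivariant f)
    (x : Fin q → Projectivization ℝ (Fin n → ℝ)) (φ v : Fin n → ℝ) (hφv : φ ⬝ᵥ v ≠ 0)
    (hx : ∀ i, φ ⬝ᵥ (x i).rep = 0 ∨ (x i).rep = v) : f x = 0 := by
  set M : Matrix (Fin n) (Fin n) ℝ := 1 - vecMulVec v ((2 / (φ ⬝ᵥ v)) • φ) with hM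
  have hmul (w : Fin n → ℝ) : M *ᵥ w = w - ((2 / (φ ⬝ᵥ v)) * (φ ⬝ᵥ w)) • v := by
    rw [hM, sub_mulVec, one_mulVec, vecMulVec_mulVec, smul_dotProduct, op_smul_eq_smul,
      smul_eq_mul]
  have hdet : M.det = -1 := by
    rw [hM, sub_eq_add_neg, ← neg_vecMulVec, vecMulVec_eq Unit,
      det_one_add_replicateCol_mul_replicateRow, smul_dotProduct, dotProduct_neg, smul_eq_mul]
    field_simp
    norm_num
  have hdet0 : M.det ≠ 0 := by rw [hdet]; norm_num
  let g : GL (Fin n) ℝ := GeneralLinearGroup.mkOfDetNeZero M hdet0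
  have hg : (g : Matrix (Fin n) (Fin n) ℝ) = M := rfl
  have hfix : (fun i => glAct g (x i)) = x := by
    funext i
    rw [← (x i).mk_rep]
    rcases hx i with h | h
    · exact glAct_mk g _ _ 1 (by rw [hg, hmul, h]; simp)
    · refine glAct_mk g _ _ (-1) ?_
      rw [hg, hmul, h, div_mul_cancel₀ _ hφv]
      module
  have key := hf g x
  rw [hfix, eps, hg, hdet, Real.sign_of_neg (by norm_num)] at key
  linarith

/-- An equivariant map vanishes on tuples having all but one of their points in a hyperplane. -/
lemma PEquivariant.eq_zero_of_hyperplane {n q : ℕ}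
    {f : (Fin q → Projectivization ℝ (Fin n → ℝ)) → ℝ} (hf : PEquivariant f)
    (x : Fin q → Projectivization ℝ (Fin n → ℝ)) {φ : Fin n → ℝ} (hφ : φ ≠ 0) (k : Fin q)
    (hx : ∀ i, i ≠ k → φ ⬝ᵥ (x i).rep = 0) : f x = 0 := by
  by_cases hk : φ ⬝ᵥ (x k).rep = 0
  · refine hf.eq_zero_of_reflection x φ φ (by simpa using hφ) fun i => Or.inl ?_
    rcases eq_or_ne i k with rfl | h
    exacts [hk, hx i h]
  · refine hf.eq_zero_of_reflection x φ _ hk fun i => ?_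
    rcases eq_or_ne i k with rfl | h
    exacts [Or.inr rfl, Or.inl (hx i h)]

lemma PEquivariant.comp_succAbove_eq_zero {n q : ℕ}
    {f : (Fin q → Projectivization ℝ (Fin n → ℝ)) → ℝ} (hf : PEquivariant f)
    (x : Fin (q + 1) → Projectivization ℝ (Fin n → ℝ)) {φ : Fin n → ℝ} (hφ : φ ≠ 0)
    {i k : Fin (q + 1)} (hki : k ≠ i)
    (hx : ∀ l, l ≠ i → l ≠ k → φ ⬝ᵥ (x l).rep = 0) : f (x ∘ i.succAbove) = 0 := by
  obtain ⟨k, rfl⟩ := Fin.exists_succAbove_eq hki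
  exact hf.eq_zero_of_hyperplane _ hφ k fun l hl =>
    hx _ (Fin.succAbove_ne i l) (Fin.succAbove_right_injective.ne hl)

/-- An equivariant map on `(n+1)`-tuples is determined by its value on the standard
projective frame. -/
lemma PEquivariant.eq_zero_of_frame {n : ℕ} (hn : 0 < n)
    {f : (Fin (n + 1) → Projectivization ℝ (Fin n → ℝ)) → ℝ} (hf : PEquivariant f)
    (h0 : f (Fin.cons (Projectivization.mk ℝ (fun _ => 1) (ones_ne_zero hn))
      (fun j : Fin n => Projectivization.mk ℝ (Pi.single j 1) (single_ne_zero' j))) = 0) :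
    f = 0 := by
  funext x
  let B : Matrix (Fin n) (Fin n) ℝ := .of fun i j => (x j.succ).rep i
  have hBcol (j : Fin n) : B.col j = (x j.succ).rep := rfl
  by_cases hB : B.det = 0
  · obtain ⟨φ, hφ, hφB⟩ := exists_vecMul_eq_zero_iff.2 hB
    refine hf.eq_zero_of_hyperplane x hφ 0 fun i hi => ?_
    obtain ⟨j, rfl⟩ := Fin.exists_succ_eq.2 hi
    exact congrFun hφB j
  have hBu : IsUnit B.det := isUnit_iff_ne_zero.2 hB
  set d := B⁻¹ *ᵥ (x 0).rep with hd
  by_cases hd0 : ∃ j, d j = 0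
  · obtain ⟨j, hj⟩ := hd0
    have hrow (k : Fin n) : B⁻¹ j ⬝ᵥ (x k.succ).rep = (1 : Matrix (Fin n) (Fin n) ℝ) j k := by
      rw [← nonsing_inv_mul B hBu]; rfl
    refine hf.eq_zero_of_hyperplane x (φ := B⁻¹ j) (fun h => ?_) j.succ fun i hi => ?_
    · simpa [h] using hrow j
    · induction i using Fin.cases with
      | zero => exact hj
      | succ k => rw [hrow, one_apply_ne]; rintro rfl; exact hi rfl
  push Not at hd0
  have hdet : (B * diagonal d).det ≠ 0 := by
    rw [det_mul, det_diagonal]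
    exact mul_ne_zero hB (Finset.prod_ne_zero_iff.2 fun j _ => hd0 j)
  let g : GL (Fin n) ℝ := GeneralLinearGroup.mkOfDetNeZero _ hdet
  have hg : (g : Matrix (Fin n) (Fin n) ℝ) = B * diagonal d := rfl
  have key := hf g (Fin.cons (Projectivization.mk ℝ (fun _ => 1) (ones_ne_zero hn))
      (fun j : Fin n => Projectivization.mk ℝ (Pi.single j 1) (single_ne_zero' j)))
  rw [h0, mul_zero] at key
  rw [Pi.zero_apply, ← key]
  congr 1
  funext i
  rw [← (x i).mk_rep]
  symm
  induction i using Fin.cases with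
  | zero =>
    refine glAct_mk g _ _ 1 ?_
    have h1 : diagonal d *ᵥ (fun _ => 1) = d := by
      funext i; rw [mulVec_diagonal, mul_one]
    rw [hg, ← mulVec_mulVec, h1, hd, mulVec_mulVec, mul_nonsing_inv B hBu, one_mulVec, one_smul]
  | succ k =>
    refine glAct_mk g _ _ (d k) ?_
    rw [hg, mulVec_single_one]
    funext i
    simp [B, mul_comm]

/-- for even `n ≥ 4` and any nonzero `GL_n(ℝ)`-equivariant map
`f : (ℙ(ℝⁿ))^{n+1} → ℝ_ε`, the coboundary of `f` evaluated at the `(n+2)`-tuple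
`(e_0, e_1, …, e_n, e_1 + e_2)` of projective points is nonzero; in particular the
coboundary of `f` does not vanish everywhere on `(ℙ(ℝⁿ))^{n+2}`. -/
theorem stmt7 (n : ℕ) (hn : 4 ≤ n) (he : Even n)
    (f : (Fin (n + 1) → Projectivization ℝ (Fin n → ℝ)) → ℝ)
    (hf : PEquivariant f) (hf0 : f ≠ 0) :
    ∑ i : Fin (n + 2), (-1 : ℝ) ^ (i : ℕ) *
      f (((Fin.snoc
          (Fin.cons (Projectivization.mk ℝ (fun _ => 1) (ones_ne_zero (by omega)))
            (fun j : Fin n => Projectivization.mk ℝ (Pi.single j 1) (single_ne_zero' j)) :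
              Fin (n + 1) → Projectivization ℝ (Fin n → ℝ))
          (Projectivization.mk ℝ
            (Pi.single (⟨0, by omega⟩ : Fin n) 1 + Pi.single (⟨1, by omega⟩ : Fin n) 1)
            (single_add_single_ne_zero (by omega))) :
            Fin (n + 2) → Projectivization ℝ (Fin n → ℝ)) ∘ i.succAbove)) ≠ 0 := by
  intro hsum
  refine hf0 (hf.eq_zero_of_frame (by omega) ?_)
  rw [Fin.sum_univ_castSucc, Finset.sum_eq_zero, zero_add, Fin.succAbove_last,
    Fin.snoc_comp_castSucc] at hsum
  · simpa using hsum
  intro i _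
  refine mul_eq_zero_of_right _ ?_
  have hdiff : (Pi.single ⟨0, by omega⟩ 1 - Pi.single ⟨1, by omega⟩ 1 : Fin n → ℝ) ≠ 0 := by
    intro h
    simpa [Pi.single_apply, Fin.ext_iff] using congrFun h ⟨0, by omega⟩
  induction i using Fin.cases with
  | zero =>
    refine hf.comp_succAbove_eq_zero _ (single_ne_zero' ⟨2, by omega⟩)
      (k := (Fin.succ ⟨2, by omega⟩).castSucc) (by simp) fun l hli hlk => ?_
    induction l using Fin.lastCases with
    | last =>
      rw [Fin.snoc_last]
      exact dotProduct_rep_mk_eq_zero _ (by simp)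
    | cast l =>
      rw [Fin.snoc_castSucc]
      induction l using Fin.cases with
      | zero => exact absurd rfl hli
      | succ l =>
        have : l ≠ ⟨2, by omega⟩ := by rintro rfl; exact hlk rfl
        rw [Fin.cons_succ]
        exact dotProduct_rep_mk_eq_zero _ (by simp [this])
  | succ j =>
    by_cases hj : (j : ℕ) < 2
    · refine hf.comp_succAbove_eq_zero _ hdiff
        (k := (Fin.succ ⟨1 - (j : ℕ), by omega⟩).castSucc)
        (by simp [Fin.ext_iff]; omega) fun l hli hlk => ?_
      induction l using Fin.lastCases with
      | last =>
        rw [Fin.snoc_last]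
        exact dotProduct_rep_mk_eq_zero _ (by simp)
      | cast l =>
        rw [Fin.snoc_castSucc]
        induction l using Fin.cases with
        | zero =>
          rw [Fin.cons_zero]
          exact dotProduct_rep_mk_eq_zero _ (by simp [dotProduct])
        | succ l =>
          simp only [ne_eq, Fin.ext_iff, Fin.val_castSucc, Fin.val_succ] at hli hlk
          have h0 : l ≠ ⟨0, by omega⟩ := by simp only [ne_eq, Fin.ext_iff]; omega
          have h1 : l ≠ ⟨1, by omega⟩ := by simp only [ne_eq, Fin.ext_iff]; omega
          rw [Fin.cons_succ]
          exact dotProduct_rep_mk_eq_zero _ (by simp [h0, h1])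
    · refine hf.comp_succAbove_eq_zero _ (single_ne_zero' j) (k := 0)
        (by simp [Fin.ext_iff]) fun l hli hlk => ?_
      induction l using Fin.lastCases with
      | last =>
        have h0 : j ≠ ⟨0, by omega⟩ := by simp only [ne_eq, Fin.ext_iff]; omega
        have h1 : j ≠ ⟨1, by omega⟩ := by simp only [ne_eq, Fin.ext_iff]; omega
        rw [Fin.snoc_last]
        exact dotProduct_rep_mk_eq_zero _ (by simp [h0, h1])
      | cast l =>
        rw [Fin.snoc_castSucc]
        induction l using Fin.cases with
        | zero => exact absurd rfl hlk
        | succ l =>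
          have : l ≠ j := by rintro rfl; exact hli rfl
          rw [Fin.cons_succ]
          exact dotProduct_rep_mk_eq_zero _ (by simp [this])

end
end

section
/- Let n be a positive even integer and let v_0,…,v_{n+1} ∈ ℝⁿ be hereditarily spanning. Then the coboundary of sul vanishes at this tuple: ∑_{i=0}^{n+1} (−1)^i sul(v_0,…,v̂_i,…,v_{n+1}) = 0. -/
noncomputable section

/-- Sign of the determinant of the matrix whose columns are `v 0, …, v (n-1)`
(zero if they do not form a basis). -/
def oriV {n : ℕ} (v : Fin n → (Fin n → ℝ)) : ℝ :=
  Real.sign (Matrix.det (Matrix.of fun i j => v j i))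

/-- A `k`-tuple of vectors of `ℝⁿ` is hereditarily spanning if every subcollection of `n`
of its entries spans `ℝⁿ`. -/
def HerSpan {n k : ℕ} (v : Fin k → (Fin n → ℝ)) : Prop :=
  ∀ s : Finset (Fin k), s.card = n → Submodule.span ℝ (v '' ↑s) = ⊤

open Classical in
/-- The Sullivan cocycle: `sul(v_0,…,v_n) = 0` unless `0` lies in the interior of the
convex hull of `{v_0,…,v_n}`, in which case `sul(v_0,…,v_n) = (−1)^i ori(v_0,…,v̂_i,…,v_n)`
(independent of `i`; we take `i = 0`). -/
def sul {n : ℕ} (v : Fin (n + 1) → (Fin n → ℝ)) : ℝ :=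
  if (0 : Fin n → ℝ) ∈ interior (convexHull ℝ (Set.range v)) then
    oriV (v ∘ (0 : Fin (n + 1)).succAbove)
  else 0

/-- A family of `n + 1` vectors in `ℝⁿ` whose linear relations vanish as soon as one coefficient
does contains `0` in the interior of its convex hull iff the coefficients of a nowhere vanishing
relation all have the same sign. -/
theorem zero_mem_interior_convexHull_iff {n : ℕ} (w : Fin (n + 1) → (Fin n → ℝ))
    (c : Fin (n + 1) → ℝ)
    (hker : ∀ a : Fin (n + 1) → ℝ, ∑ j, a j • w j = 0 → ∀ i, a i = 0 → a = 0)
    (hc : ∑ j, c j • w j = 0) (hc0 : ∀ j, c j ≠ 0) :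
    (0 : Fin n → ℝ) ∈ interior (convexHull ℝ (Set.range w)) ↔
      (∀ j, 0 < c j) ∨ (∀ j, c j < 0) := by
  constructor
  · intro h
    have htop : affineSpan ℝ (Set.range w) = ⊤ :=
      affineSpan_eq_top_of_nonempty_interior ⟨0, h⟩
    have hind : AffineIndependent ℝ w := by
      rw [affineIndependent_iff_finrank_vectorSpan_eq ℝ w (n := n) (by simp),
        ← direction_affineSpan, htop, AffineSubspace.direction_top]
      simp
    let b : AffineBasis (Fin (n + 1)) ℝ (Fin n → ℝ) := ⟨w, hind, htop⟩
    have hpos : ∀ j, 0 < b.coord j 0 := by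
      have := b.interior_convexHull
      change interior (convexHull ℝ (Set.range w)) = _ at this
      rw [this] at h
      exact h
    have hrel : ∑ j, b.coord j 0 • w j = 0 := b.linear_combination_coord_eq_self 0
    have hprop : (fun j => c j * b.coord 0 0 - c 0 * b.coord j 0) = 0 := by
      refine hker _ ?_ 0 (by simp)
      simp only [sub_smul, Finset.sum_sub_distrib]
      have h1 : ∑ j, (c j * b.coord 0 0) • w j = 0 := by
        simp_rw [mul_comm (c _), mul_smul, ← Finset.smul_sum, hc, smul_zero]
      have h2 : ∑ j, (c 0 * b.coord j 0) • w j = 0 := by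
        simp_rw [mul_smul, ← Finset.smul_sum, hrel, smul_zero]
      rw [h1, h2, sub_zero]
    have hprop' : ∀ j, c j * b.coord 0 0 = c 0 * b.coord j 0 := fun j =>
      sub_eq_zero.1 (congrFun hprop j)
    rcases (hc0 0).lt_or_gt with h0 | h0
    · right
      intro j
      have := mul_neg_of_neg_of_pos h0 (hpos j)
      rw [← hprop' j] at this
      exact neg_of_mul_neg_left this (hpos 0).le
    · left
      intro j
      have := mul_pos h0 (hpos j)
      rw [← hprop' j] at this
      exact pos_of_mul_pos_left this (hpos 0).le
  · intro h
    have hS : ∑ j, c j ≠ 0 := by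
      rcases h with h | h
      · exact (Finset.sum_pos (fun j _ => h j) Finset.univ_nonempty).ne'
      · exact (Finset.sum_neg (fun j _ => h j) Finset.univ_nonempty).ne
    have hind : AffineIndependent ℝ w := by
      rw [affineIndependent_iff_of_fintype]
      intro a ha hsum
      rw [Finset.weightedVSub_eq_linear_combination _ ha] at hsum
      have hprop : (fun j => a j * c 0 - a 0 * c j) = 0 := by
        refine hker _ ?_ 0 (by ring)
        simp only [sub_smul, Finset.sum_sub_distrib]
        have h1 : ∑ j, (a j * c 0) • w j = 0 := by
          simp_rw [mul_comm (a _), mul_smul, ← Finset.smul_sum, hsum, smul_zero]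
        have h2 : ∑ j, (a 0 * c j) • w j = 0 := by
          simp_rw [mul_smul, ← Finset.smul_sum, hc, smul_zero]
        rw [h1, h2, sub_zero]
      have hs : ∑ j, (a j * c 0 - a 0 * c j) = 0 :=
        Finset.sum_eq_zero fun j _ => congrFun hprop j
      rw [Finset.sum_sub_distrib, ← Finset.sum_mul, ← Finset.mul_sum, ha, zero_mul, zero_sub,
        neg_eq_zero] at hs
      have ha0 : a 0 = 0 := (mul_eq_zero.1 hs).resolve_right hS
      exact congrFun (hker a hsum 0 ha0)
    have htop : affineSpan ℝ (Set.range w) = ⊤ := by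
      rw [hind.affineSpan_eq_top_iff_card_eq_finrank_add_one]
      simp
    let b : AffineBasis (Fin (n + 1)) ℝ (Fin n → ℝ) := ⟨w, hind, htop⟩
    have hb := b.interior_convexHull
    change interior (convexHull ℝ (Set.range w)) = _ at hb
    rw [hb]
    intro i
    have hone : ∑ j, c j / ∑ k, c k = 1 := by
      rw [← Finset.sum_div, div_self hS]
    have hcomb : Finset.univ.affineCombination ℝ b (fun j => c j / ∑ k, c k) = 0 := by
      rw [Finset.affineCombination_eq_linear_combination _ _ _ hone]
      change ∑ j, (c j / ∑ k, c k) • w j = 0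
      simp_rw [div_eq_inv_mul, mul_smul, ← Finset.smul_sum, hc, smul_zero]
    have hcoord := b.coord_apply_combination_of_mem (Finset.mem_univ i) hone
    rw [hcomb] at hcoord
    rw [hcoord]
    rcases h with h | h
    · exact div_pos (h i) (Finset.sum_pos (fun j _ => h j) Finset.univ_nonempty)
    · exact div_pos_of_neg_of_neg (h i) (Finset.sum_neg (fun j _ => h j) Finset.univ_nonempty)

/-- In the tournament given by the signs of an alternating matrix of rank two which is nonzero off
the diagonal, the existence of a source forces the existence of a sink. -/
theorem exists_sink_of_source {ι : Type*} [Fintype ι] [DecidableEq ι] [Nontrivial ι]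
    (B : ι → ι → ℝ) (hanti : ∀ i j, B i j = -B j i)
    (hplucker : ∀ s j k l, B s j * B k l - B s k * B j l + B j k * B s l = 0)
    (hne : ∀ i j, i ≠ j → B i j ≠ 0) {s : ι} (hs : ∀ j, j ≠ s → 0 < B s j) :
    ∃ k, ∀ j, j ≠ k → B k j < 0 := by
  obtain ⟨t, ht⟩ := exists_ne s
  obtain ⟨k, hk, hmax⟩ := (Finset.univ.erase s).exists_max_image (fun k => B t k / B s k)
    ⟨t, by simpa using ht⟩
  have hks : k ≠ s := by simpa using hk
  refine ⟨k, fun j hj => ?_⟩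
  rcases eq_or_ne j s with rfl | hjs
  · rw [hanti]
    exact neg_neg_of_pos (hs k hks)
  · have hle := hmax j (by simpa using hjs)
    rw [div_le_div_iff₀ (hs j hjs) (hs k hks)] at hle
    have hp := hplucker s t k j
    rcases (hne k j hj.symm).lt_or_gt with h | h
    · exact h
    · have := mul_pos (hs t ht) h
      nlinarith

/-- In the tournament given by the signs of an alternating matrix of rank two which is nonzero off
the diagonal, there are as many sources as sinks. -/
theorem sum_source_eq_sum_sink {ι : Type*} [Fintype ι] [DecidableEq ι] [Nontrivial ι]
    (B : ι → ι → ℝ) (hanti : ∀ i j, B i j = -B j i)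
    (hplucker : ∀ s j k l, B s j * B k l - B s k * B j l + B j k * B s l = 0)
    (hne : ∀ i j, i ≠ j → B i j ≠ 0)
    [DecidablePred fun i => ∀ j, j ≠ i → 0 < B i j]
    [DecidablePred fun i => ∀ j, j ≠ i → B i j < 0] :
    (∑ i, if ∀ j, j ≠ i → 0 < B i j then (1 : ℝ) else 0) =
      ∑ i, if ∀ j, j ≠ i → B i j < 0 then (1 : ℝ) else 0 := by
  have key : ∀ (P : ι → Prop) [DecidablePred P] [Decidable (∃ i, P i)], (∀ i j, P i → P j → i = j) →
      (∑ i, if P i then (1 : ℝ) else 0) = if ∃ i, P i then 1 else 0 := by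
    intro P _ _ hP
    split_ifs with h
    · obtain ⟨i, hi⟩ := h
      rw [Finset.sum_eq_single i, if_pos hi]
      · intro j _ hj
        exact if_neg fun h => hj (hP _ _ h hi)
      · simp
    · push Not at h
      exact Finset.sum_eq_zero fun i _ => if_neg (h i)
  classical
  rw [key fun i => ∀ j, j ≠ i → 0 < B i j, key fun i => ∀ j, j ≠ i → B i j < 0]
  · refine if_congr ⟨fun ⟨s, hs⟩ => exists_sink_of_source B hanti hplucker hne hs,
      fun ⟨s, hs⟩ => ?_⟩ rfl rfl
    obtain ⟨k, hk⟩ := exists_sink_of_source (fun i j => B j i) (fun i j => hanti j i)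
      (fun s j k l => by
        have := hplucker s j k l
        rw [hanti j s, hanti l k, hanti k s, hanti l j, hanti k j, hanti l s]
        linarith) (fun i j h => hne j i h.symm) (s := s)
      (fun j hj => by have := hs j hj; rw [hanti] at this; linarith)
    refine ⟨k, fun j hj => ?_⟩
    have := hk j hj
    rw [hanti]
    linarith
  · intro i j hi hj
    by_contra h
    have h1 := hi j (Ne.symm h)
    have h2 := hj i h
    rw [hanti] at h1
    linarith
  · intro i j hi hj
    by_contra h
    have h1 := hi j (Ne.symm h)
    have h2 := hj i h
    rw [hanti] at h1
    linarith

theorem HerSpan.eq_zero_of_sum_smul_eq_zero {n : ℕ} {v : Fin (n + 2) → (Fin n → ℝ)}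
    (hv : HerSpan v) {a : Fin (n + 2) → ℝ} (ha : ∑ j, a j • v j = 0) {i k : Fin (n + 2)}
    (hik : i ≠ k) (hi : a i = 0) (hk : a k = 0) : a = 0 := by
  have hcard : (Finset.univ \ {i, k} : Finset (Fin (n + 2))).card = n := by
    rw [Finset.card_sdiff_of_subset (Finset.subset_univ _), Finset.card_pair hik]
    simp
  set s : Finset (Fin (n + 2)) := Finset.univ \ {i, k} with hs
  have hmem : ∀ j, j ∉ s → a j = 0 := by
    intro j hj
    have : j = i ∨ j = k := by simpa [hs, or_iff_not_imp_left] using hj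
    rcases this with rfl | rfl <;> assumption
  have hli : LinearIndependent ℝ (fun j : s => v j) := by
    refine linearIndependent_of_top_le_span_of_card_eq_finrank ?_ (by simp [hcard])
    rw [← hv s hcard, Set.image_eq_range]
    rfl
  have hsum : ∑ j : s, a j • v j = 0 := by
    rw [Finset.sum_coe_sort s (fun j => a j • v j), ← ha]
    exact Finset.sum_subset (Finset.subset_univ _) fun j _ hj => by rw [hmem j hj, zero_smul]
  have := Fintype.linearIndependent_iff.1 hli (fun j => a j) hsum
  funext j
  by_cases hj : j ∈ s
  · exact this ⟨j, hj⟩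
  · exact hmem j hj

/-- The `(n + 2) × (n + 2)` matrix with first rows `x` and `y`, followed by the rows of the matrix
whose columns are the `v j`. -/
def borderedMatrix {n : ℕ} (v : Fin (n + 2) → (Fin n → ℝ)) (x y : Fin (n + 2) → ℝ) :
    Matrix (Fin (n + 2)) (Fin (n + 2)) ℝ :=
  Matrix.of (Fin.cons x (Fin.cons y fun k j => v j k))

/-- Up to sign, the maximal minor of `v` omitting the columns `i` and `j`. -/
def complMinor {n : ℕ} (v : Fin (n + 2) → (Fin n → ℝ)) (i j : Fin (n + 2)) : ℝ :=
  (borderedMatrix v (Pi.single i 1) (Pi.single j 1)).det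

theorem complMinor_antisymm {n : ℕ} (v : Fin (n + 2) → (Fin n → ℝ)) (i j : Fin (n + 2)) :
    complMinor v i j = -complMinor v j i := by
  have h := Matrix.det_permute (Equiv.swap (0 : Fin (n + 2)) 1)
    (borderedMatrix v (Pi.single j 1) (Pi.single i 1))
  rw [Equiv.Perm.sign_swap (by simp)] at h
  simp only [Units.val_neg, Units.val_one, Int.cast_neg, Int.cast_one, neg_mul, one_mul] at h
  rw [complMinor, complMinor, ← h]
  congr 1
  ext a b
  refine Fin.cases ?_ (fun a => Fin.cases ?_ (fun a => ?_) a) a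
  · simp [borderedMatrix]
  · simp [borderedMatrix]
  · rw [Matrix.submatrix_apply, Equiv.swap_apply_of_ne_of_ne (Fin.succ_ne_zero _)
      (by rw [← Fin.succ_zero_eq_one, Ne, Fin.succ_inj]; exact Fin.succ_ne_zero _)]
    simp [borderedMatrix]

theorem sum_complMinor_smul {n : ℕ} (v : Fin (n + 2) → (Fin n → ℝ)) (i : Fin (n + 2)) :
    ∑ j, complMinor v i j • v j = 0 := by
  have hupd : ∀ y, borderedMatrix v (Pi.single i 1) y =
      (borderedMatrix v (Pi.single i 1) 0).updateRow 1 y := by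
    intro y
    ext a b
    refine Fin.cases ?_ (fun a => Fin.cases ?_ (fun a => ?_) a) a
    · simp [borderedMatrix, Matrix.updateRow_apply]
    · simp [borderedMatrix, Matrix.updateRow_apply]
    · simp [borderedMatrix, Matrix.updateRow_apply, ← Fin.succ_zero_eq_one, -Fin.succ_zero_eq_one']
  funext k
  have hlin : ∑ j, v j k * complMinor v i j =
      (borderedMatrix v (Pi.single i 1) fun j => v j k).det := by
    simp only [complMinor]
    rw [hupd fun j => v j k, pi_eq_sum_univ' fun j => v j k]
    simp_rw [fun j => hupd (Pi.single j 1), ← Matrix.det_updateRow_smul]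
    exact (map_sum (Matrix.detRowAlternating.toMultilinearMap.toLinearMap
      (borderedMatrix v (Pi.single i 1) 0) 1) _ _).symm
  rw [Matrix.det_zero_of_row_eq (i := 1) (j := k.succ.succ)
    (by rw [← Fin.succ_zero_eq_one, Ne, Fin.succ_inj]; exact (Fin.succ_ne_zero _).symm)
    (by ext b; simp [borderedMatrix])] at hlin
  simpa [Finset.sum_apply, mul_comm] using hlin

theorem complMinor_succAbove_zero {n : ℕ} (v : Fin (n + 2) → (Fin n → ℝ)) (i : Fin (n + 2)) :
    complMinor v i (i.succAbove 0) = (-1) ^ (i : ℕ) *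
      (Matrix.of fun a b => (v ∘ i.succAbove ∘ (0 : Fin (n + 1)).succAbove) b a).det := by
  rw [complMinor, Matrix.det_succ_row_zero, Finset.sum_eq_single i]
  · rw [Matrix.det_succ_row_zero, Finset.sum_eq_single 0]
    · simp [borderedMatrix]
      rfl
    · intro b _ hb
      simp [borderedMatrix, hb]
    · simp
  · intro b _ hb
    simp [borderedMatrix, hb]
  · simp

theorem HerSpan.complMinor_ne_zero {n : ℕ} {v : Fin (n + 2) → (Fin n → ℝ)} (hv : HerSpan v)
    {i j : Fin (n + 2)} (hij : i ≠ j) : complMinor v i j ≠ 0 := by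
  intro h
  obtain ⟨a, ha, hMa⟩ := Matrix.exists_mulVec_eq_zero_iff.2 h
  refine ha (hv.eq_zero_of_sum_smul_eq_zero ?_ hij ?_ ?_)
  · funext k
    have := congrFun hMa k.succ.succ
    simpa [borderedMatrix, Matrix.mulVec, dotProduct, mul_comm] using this
  · have := congrFun hMa 0
    simpa [borderedMatrix, Matrix.mulVec] using this
  · have := congrFun hMa 1
    simpa [borderedMatrix, Matrix.mulVec] using this

theorem complMinor_self {n : ℕ} (v : Fin (n + 2) → (Fin n → ℝ)) (i : Fin (n + 2)) :
    complMinor v i i = 0 := by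
  have := complMinor_antisymm v i i
  linarith

theorem HerSpan.complMinor_plucker {n : ℕ} {v : Fin (n + 2) → (Fin n → ℝ)} (hv : HerSpan v)
    (s j k l : Fin (n + 2)) :
    complMinor v s j * complMinor v k l - complMinor v s k * complMinor v j l +
      complMinor v j k * complMinor v s l = 0 := by
  rcases eq_or_ne s j with rfl | hsj
  · rw [complMinor_self]
    ring
  refine congrFun (hv.eq_zero_of_sum_smul_eq_zero (a := fun l => complMinor v s j *
    complMinor v k l - complMinor v s k * complMinor v j l +
      complMinor v j k * complMinor v s l) ?_ hsj ?_ ?_) l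
  · simp only [add_smul, sub_smul, mul_smul, Finset.sum_add_distrib, Finset.sum_sub_distrib,
      ← Finset.smul_sum, sum_complMinor_smul, smul_zero, sub_zero, add_zero]
  · rw [complMinor_self, complMinor_antisymm v k s, complMinor_antisymm v j s]
    ring
  · rw [complMinor_self, complMinor_antisymm v k j]
    ring

theorem HerSpan.neg_one_pow_mul_sul {n : ℕ} {v : Fin (n + 2) → (Fin n → ℝ)} (hv : HerSpan v)
    (i : Fin (n + 2)) :
    (-1 : ℝ) ^ (i : ℕ) * sul (v ∘ i.succAbove) =
      (if ∀ j, j ≠ i → 0 < complMinor v i j then (1 : ℝ) else 0) -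
        if ∀ j, j ≠ i → complMinor v i j < 0 then (1 : ℝ) else 0 := by
  classical
  have hmem := zero_mem_interior_convexHull_iff (v ∘ i.succAbove)
    (fun j => complMinor v i (i.succAbove j)) (fun a ha j hj => by
      have := hv.eq_zero_of_sum_smul_eq_zero (a := i.insertNth 0 a)
        (by rw [Fin.sum_univ_succAbove _ i]; simpa using ha)
        (Fin.succAbove_ne i j).symm (by simp) (by simpa using hj)
      funext k
      simpa using congrFun this (i.succAbove k))
    (by
      have := sum_complMinor_smul v i
      rw [Fin.sum_univ_succAbove _ i, complMinor_self] at this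
      simpa using this)
    (fun j => hv.complMinor_ne_zero (Fin.succAbove_ne i j).symm)
  have hall : ∀ P : Fin (n + 2) → Prop, (∀ j, P (i.succAbove j)) ↔ ∀ j, j ≠ i → P j := by
    refine fun P => ⟨fun h j hj => ?_, fun h j => h _ (Fin.succAbove_ne i j)⟩
    obtain ⟨k, rfl⟩ := Fin.exists_succAbove_eq hj
    exact h k
  rw [hall fun j => 0 < complMinor v i j, hall fun j => complMinor v i j < 0] at hmem
  have hsign : (-1 : ℝ) ^ (i : ℕ) * oriV ((v ∘ i.succAbove) ∘ (0 : Fin (n + 1)).succAbove) =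
      Real.sign (complMinor v i (i.succAbove 0)) := by
    rw [complMinor_succAbove_zero, oriV]
    rcases neg_one_pow_eq_or ℝ (i : ℕ) with h | h <;>
      simp only [h, one_mul, neg_mul, Real.sign_neg] <;> rfl
  have hne := Fin.succAbove_ne i 0
  rw [sul]
  by_cases hp : ∀ j, j ≠ i → 0 < complMinor v i j
  · rw [if_pos (hmem.2 (.inl hp)), hsign, if_pos hp, if_neg fun h => (hp _ hne).asymm (h _ hne),
      Real.sign_of_pos (hp _ hne), sub_zero]
  · by_cases hm : ∀ j, j ≠ i → complMinor v i j < 0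
    · rw [if_pos (hmem.2 (.inr hm)), hsign, if_neg hp, if_pos hm, Real.sign_of_neg (hm _ hne),
        zero_sub]
    · rw [if_neg fun h => (hmem.1 h).elim hp hm, if_neg hp, if_neg hm, mul_zero, sub_zero]

/-- the coboundary of `sul` vanishes on hereditarily spanning
`(n+2)`-tuples: `∑_{i=0}^{n+1} (−1)^i sul(v_0,…,v̂_i,…,v_{n+1}) = 0`. -/
theorem stmt17 (n : ℕ) (hn : 0 < n) (he : Even n)
    (v : Fin (n + 2) → (Fin n → ℝ)) (hv : HerSpan v) :
    ∑ i : Fin (n + 2), (-1 : ℝ) ^ (i : ℕ) * sul (v ∘ i.succAbove) = 0 := by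
  simp_rw [hv.neg_one_pow_mul_sul]
  rw [Finset.sum_sub_distrib, sub_eq_zero]
  exact sum_source_eq_sum_sink (complMinor v) (complMinor_antisymm v) hv.complMinor_plucker
    fun _ _ h => hv.complMinor_ne_zero h

end
end

section
/- Let n be a positive even integer and define smi(v_0,…,v_n) = 2^{−(n+1)} ∑_{(σ_0,…,σ_n) ∈ {±1}^{n+1}} sul(σ_0 v_0,…,σ_n v_n) for v_0,…,v_n ∈ ℝⁿ. Then: (i) smi(v_0,…,λ v_j,…,v_n) = smi(v_0,…,v_n) for every j and every nonzero scalar λ, so smi descends to a map on (ℙ(ℝⁿ))^{n+1}; (ii) smi(g v_0,…,g v_n) = ε(g)·smi(v_0,…,v_n) for every g ∈ GL_n(ℝ), where ε(g) is the sign of det g; (iii) ∑_{i=0}^{n+1} (−1)^i smi(v_0,…,v̂_i,…,v_{n+1}) = 0 whenever (v_0,…,v_{n+1}) is hereditarily spanning. -/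
open Matrix

noncomputable section

/-- Smillie's averaged cocycle: `smi(v_0,…,v_n) = 2^{−(n+1)} ∑_{σ ∈ {±1}^{n+1}}
sul(σ_0 v_0, …, σ_n v_n)`. -/
def smi {n : ℕ} (v : Fin (n + 1) → (Fin n → ℝ)) : ℝ :=
  ((2 : ℝ) ^ (n + 1))⁻¹ *
    ∑ σ : Fin (n + 1) → Bool, sul (fun i => (if σ i then (1 : ℝ) else -1) • v i)

/-- The signed maximal minors of an `n × (n+1)` matrix with columns `v`. They are the coefficients
of the linear relation between the `v k` given by Cramer's rule. -/
def signedMinor {n : ℕ} (v : Fin (n + 1) → (Fin n → ℝ)) (k : Fin (n + 1)) : ℝ :=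
  (-1) ^ (k : ℕ) * det (of fun i j => v (k.succAbove j) i)

theorem det_vecCons {n : ℕ} (v : Fin (n + 1) → (Fin n → ℝ)) (x : Fin (n + 1) → ℝ) :
    det (of (vecCons x fun r k => v k r)) = ∑ k, signedMinor v k * x k := by
  rw [det_succ_row_zero]
  refine Finset.sum_congr rfl fun k _ => ?_
  rw [signedMinor, mul_right_comm]
  rfl

theorem sum_signedMinor_mul {n : ℕ} (v : Fin (n + 1) → (Fin n → ℝ)) (r : Fin n) :
    ∑ k, signedMinor v k * v k r = 0 := by
  rw [← det_vecCons v fun k => v k r]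
  exact det_zero_of_row_eq (i := 0) (j := r.succ) (Fin.succ_ne_zero r).symm (by ext; simp)

theorem vecCons_one_mulVec_eq_iff {n : ℕ} (v : Fin (n + 1) → (Fin n → ℝ)) (c : Fin (n + 1) → ℝ)
    (s : ℝ) :
    of (vecCons 1 fun r k => v k r) *ᵥ c = Pi.single 0 s ↔
      ∑ k, c k = s ∧ ∑ k, c k • v k = 0 := by
  rw [funext_iff, Fin.forall_fin_succ, funext_iff]
  simp [mulVec, dotProduct, Finset.sum_apply, mul_comm]

theorem affineIndependent_iff_sum_signedMinor_ne_zero {n : ℕ} (v : Fin (n + 1) → (Fin n → ℝ)) :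
    AffineIndependent ℝ v ↔ ∑ k, signedMinor v k ≠ 0 := by
  have h : ∑ k, signedMinor v k = det (of (vecCons 1 fun r k => v k r)) := by
    simp [det_vecCons]
  rw [h, ne_eq, ← exists_mulVec_eq_zero_iff, affineIndependent_iff_of_fintype]
  have key : ∀ c : Fin (n + 1) → ℝ, of (vecCons 1 fun r k => v k r) *ᵥ c = 0 ↔
      ∑ k, c k = 0 ∧ ∑ k, c k • v k = 0 := fun c => by
    simpa using vecCons_one_mulVec_eq_iff v c 0
  simp only [key]
  constructor
  · rintro hv ⟨c, hc, hs, hc0⟩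
    refine hc (funext fun i => hv c hs ?_ i)
    rwa [Finset.weightedVSub_eq_linear_combination _ hs]
  · intro hv c hs hc0 i
    rw [Finset.weightedVSub_eq_linear_combination _ hs] at hc0
    by_contra hi
    exact hv ⟨c, fun h => hi (congrFun h i), hs, hc0⟩

theorem eq_sum_signedMinor_mul {n : ℕ} {v : Fin (n + 1) → (Fin n → ℝ)}
    (hv : AffineIndependent ℝ v) {c : Fin (n + 1) → ℝ} (hs : ∑ k, c k = 1)
    (hc : ∑ k, c k • v k = 0) (k : Fin (n + 1)) :
    signedMinor v k = (∑ l, signedMinor v l) * c k := by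
  rw [← sub_eq_zero]
  refine affineIndependent_iff.1 hv Finset.univ
    (fun k => signedMinor v k - (∑ l, signedMinor v l) * c k) ?_ ?_ k (Finset.mem_univ k)
  · rw [Finset.sum_sub_distrib, ← Finset.mul_sum, hs, mul_one, sub_self]
  · simp only [sub_smul, mul_smul, Finset.sum_sub_distrib, ← Finset.smul_sum, hc, smul_zero,
      sub_zero]
    ext r
    simpa [Finset.sum_apply] using sum_signedMinor_mul v r

theorem zero_mem_interior_convexHull_iff_s18 {n : ℕ} (v : Fin (n + 1) → (Fin n → ℝ)) :
    (0 : Fin n → ℝ) ∈ interior (convexHull ℝ (Set.range v)) ↔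
      (∀ k, 0 < signedMinor v k) ∨ ∀ k, signedMinor v k < 0 := by
  have basis : AffineIndependent ℝ v → affineSpan ℝ (Set.range v) = ⊤ →
      ((0 : Fin n → ℝ) ∈ interior (convexHull ℝ (Set.range v)) ↔
        ∀ k, 0 < signedMinor v k / ∑ l, signedMinor v l) := fun hv ht => by
    let b : AffineBasis (Fin (n + 1)) ℝ (Fin n → ℝ) := ⟨v, hv, ht⟩
    have hb : interior (convexHull ℝ (Set.range v)) = {x | ∀ i, 0 < b.coord i x} :=
      b.interior_convexHull
    have hc := eq_sum_signedMinor_mul hv (b.sum_coord_apply_eq_one 0)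
      (b.linear_combination_coord_eq_self 0)
    rw [hb, Set.mem_ofPred_eq]
    refine forall_congr' fun k => ?_
    rw [hc k, mul_div_cancel_left₀]
    exact (affineIndependent_iff_sum_signedMinor_ne_zero v).1 hv
  constructor
  · intro h
    have ht := interior_convexHull_nonempty_iff_affineSpan_eq_top.1 ⟨0, h⟩
    have hv : AffineIndependent ℝ v := by
      rw [affineIndependent_iff_finrank_vectorSpan_eq ℝ v (n := n) (by simp),
        ← direction_affineSpan, ht, AffineSubspace.direction_top, finrank_top,
        Module.finrank_fin_fun]
    rw [basis hv ht] at h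
    rcases lt_or_gt_of_ne ((affineIndependent_iff_sum_signedMinor_ne_zero v).1 hv) with hs | hs
    · exact Or.inr fun k => by simpa [hs, hs.not_gt] using div_pos_iff.1 (h k)
    · exact Or.inl fun k => by simpa [hs, hs.not_gt] using div_pos_iff.1 (h k)
  · intro h
    have hs : (∀ k, 0 < signedMinor v k) ∧ 0 < ∑ k, signedMinor v k ∨
        (∀ k, signedMinor v k < 0) ∧ ∑ k, signedMinor v k < 0 :=
      h.imp (fun h => ⟨h, Finset.sum_pos (fun k _ => h k) Finset.univ_nonempty⟩)
        fun h => ⟨h, Finset.sum_neg (fun k _ => h k) Finset.univ_nonempty⟩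
    have hv : AffineIndependent ℝ v := (affineIndependent_iff_sum_signedMinor_ne_zero v).2
      (hs.elim (fun h => h.2.ne') fun h => h.2.ne)
    rw [basis hv (hv.affineSpan_eq_top_iff_card_eq_finrank_add_one.2 (by simp))]
    exact fun k => hs.elim (fun h => div_pos (h.1 k) h.2) fun h => div_pos_of_neg_of_neg (h.1 k) h.2

theorem sul_of_pos {n : ℕ} {v : Fin (n + 1) → (Fin n → ℝ)} (h : ∀ k, 0 < signedMinor v k) :
    sul v = 1 := by
  rw [sul, if_pos ((zero_mem_interior_convexHull_iff_s18 v).2 (Or.inl h))]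
  exact Real.sign_of_pos (by simpa [signedMinor] using h 0)

theorem sul_of_neg {n : ℕ} {v : Fin (n + 1) → (Fin n → ℝ)} (h : ∀ k, signedMinor v k < 0) :
    sul v = -1 := by
  rw [sul, if_pos ((zero_mem_interior_convexHull_iff_s18 v).2 (Or.inr h))]
  exact Real.sign_of_neg (by simpa [signedMinor] using h 0)

theorem sul_of_not {n : ℕ} {v : Fin (n + 1) → (Fin n → ℝ)}
    (h : ¬((∀ k, 0 < signedMinor v k) ∨ ∀ k, signedMinor v k < 0)) : sul v = 0 := by
  rw [sul, if_neg (mt (zero_mem_interior_convexHull_iff_s18 v).1 h)]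

theorem signedMinor_smul_mul {n : ℕ} (v : Fin (n + 1) → (Fin n → ℝ)) (c : Fin (n + 1) → ℝ)
    (k : Fin (n + 1)) :
    signedMinor (fun i => c i • v i) k * c k = (∏ i, c i) * signedMinor v k := by
  have h : det (of fun i j => c (k.succAbove j) * v (k.succAbove j) i) =
      (∏ j, c (k.succAbove j)) * det (of fun i j => v (k.succAbove j) i) :=
    det_mul_row (fun j => c (k.succAbove j)) (of fun i j => v (k.succAbove j) i)
  simp only [signedMinor, Pi.smul_apply, smul_eq_mul, h, Fin.prod_univ_succAbove c k]
  ring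

theorem signedMinor_mulVec {n : ℕ} (v : Fin (n + 1) → (Fin n → ℝ)) (g : Matrix (Fin n) (Fin n) ℝ)
    (k : Fin (n + 1)) :
    signedMinor (fun i => g *ᵥ v i) k = det g * signedMinor v k := by
  have h : (of fun i j => (g *ᵥ v (k.succAbove j)) i) = g * of fun i j => v (k.succAbove j) i := rfl
  rw [signedMinor, h, det_mul, signedMinor, mul_left_comm]

theorem Real.sign_mul (a b : ℝ) : Real.sign (a * b) = Real.sign a * Real.sign b := by
  rcases lt_trichotomy a 0 with ha | rfl | ha <;> rcases lt_trichotomy b 0 with hb | rfl | hb <;>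
    simp [Real.sign_of_neg, Real.sign_of_pos, mul_pos_of_neg_of_neg, mul_neg_of_neg_of_pos,
      mul_neg_of_pos_of_neg, *]

theorem Real.sign_prod {ι : Type*} (s : Finset ι) (f : ι → ℝ) :
    Real.sign (∏ i ∈ s, f i) = ∏ i ∈ s, Real.sign (f i) :=
  map_prod (⟨⟨Real.sign, Real.sign_one⟩, Real.sign_mul⟩ : ℝ →* ℝ) f s

/-- The real number `±1` encoded by a Boolean. -/
def boolSign (b : Bool) : ℝ := if b then 1 else -1

theorem boolSign_mul_self (b : Bool) : boolSign b * boolSign b = 1 := by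
  cases b <;> simp [boolSign]

theorem boolSign_not (b : Bool) : boolSign (!b) = -boolSign b := by
  cases b <;> simp [boolSign]

theorem boolSign_decide_pos {a : ℝ} (ha : a ≠ 0) : boolSign (decide (0 < a)) = Real.sign a := by
  rcases ha.lt_or_gt with h | h
  · simp [boolSign, h.not_gt, Real.sign_of_neg h]
  · simp [boolSign, h, Real.sign_of_pos h]

theorem prod_boolSign {ι : Type*} (s : Finset ι) (σ : ι → Bool) :
    ∏ i ∈ s, boolSign (σ i) = 1 ∨ ∏ i ∈ s, boolSign (σ i) = -1 := by
  rw [← mul_self_eq_one_iff, ← Finset.prod_mul_distrib]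
  exact Finset.prod_eq_one fun i _ => boolSign_mul_self _

theorem signedMinor_boolSign_smul {n : ℕ} (v : Fin (n + 1) → (Fin n → ℝ))
    (σ : Fin (n + 1) → Bool) (k : Fin (n + 1)) :
    signedMinor (fun i => boolSign (σ i) • v i) k =
      (∏ i, boolSign (σ i)) * (boolSign (σ k) * signedMinor v k) := by
  rw [mul_left_comm, ← signedMinor_smul_mul v fun i => boolSign (σ i), mul_left_comm,
    boolSign_mul_self, mul_one]

theorem sul_of_signedMinor_eq {n : ℕ} {v : Fin (n + 1) → (Fin n → ℝ)} {s : ℝ}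
    (hs : s = 1 ∨ s = -1) {a : Fin (n + 1) → ℝ} (ha : ∀ k, 0 < a k)
    (h : ∀ k, signedMinor v k = s * a k) : sul v = s := by
  rcases hs with rfl | rfl
  · exact sul_of_pos fun k => by simpa [h] using ha k
  · exact sul_of_neg fun k => by simpa [h] using ha k

/-- If no signed minor vanishes, exactly two opposite choices of signs move `0` into the interior
of the convex hull. -/
theorem sul_boolSign_smul {n : ℕ} (he : Even n) {v : Fin (n + 1) → (Fin n → ℝ)}
    (hv : ∀ k, signedMinor v k ≠ 0) (σ : Fin (n + 1) → Bool) :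
    sul (fun i => boolSign (σ i) • v i) =
      (if σ = fun k => decide (0 < signedMinor v k) then
        Real.sign (∏ k, signedMinor v k) else 0) +
      if σ = fun k => !decide (0 < signedMinor v k) then
        Real.sign (∏ k, signedMinor v k) else 0 := by
  have hprod : ∏ k, boolSign (decide (0 < signedMinor v k)) = Real.sign (∏ k, signedMinor v k) := by
    rw [Real.sign_prod]
    exact Finset.prod_congr rfl fun k _ => boolSign_decide_pos (hv k)
  have hone : Real.sign (∏ k, signedMinor v k) = 1 ∨ Real.sign (∏ k, signedMinor v k) = -1 := by
    rw [← hprod]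
    exact prod_boolSign _ _
  have hpos : ∀ k, 0 < Real.sign (signedMinor v k) * signedMinor v k := fun k =>
    Real.sign_mul_pos_of_ne_zero _ (hv k)
  have hne : (fun k => decide (0 < signedMinor v k)) ≠ fun k => !decide (0 < signedMinor v k) :=
    fun h => by simpa using congrFun h 0
  by_cases h₁ : σ = fun k => decide (0 < signedMinor v k)
  · subst h₁
    rw [if_pos rfl, if_neg hne, add_zero]
    refine sul_of_signedMinor_eq hone hpos fun k => ?_
    rw [signedMinor_boolSign_smul, hprod, boolSign_decide_pos (hv k)]
  by_cases h₂ : σ = fun k => !decide (0 < signedMinor v k)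
  · subst h₂
    rw [if_neg hne.symm, if_pos rfl, zero_add]
    refine sul_of_signedMinor_eq hone hpos fun k => ?_
    rw [signedMinor_boolSign_smul]
    simp only [boolSign_not, Finset.prod_neg, hprod, boolSign_decide_pos (hv k), Finset.card_univ,
      Fintype.card_fin, he.add_one.neg_one_pow]
    ring
  rw [if_neg h₁, if_neg h₂, add_zero]
  refine sul_of_not fun h => ?_
  have hσ : (∀ k, 0 < boolSign (σ k) * signedMinor v k) ∨
      ∀ k, boolSign (σ k) * signedMinor v k < 0 := by
    simp only [signedMinor_boolSign_smul] at h
    rcases prod_boolSign Finset.univ σ with hP | hP <;> simp only [hP] at h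
    · simpa using h
    · simpa [or_comm] using h
  rcases hσ with hσ | hσ
  · refine h₁ (funext fun k => ?_)
    have := hσ k
    cases hk : σ k <;> simp_all [boolSign, le_of_lt]
  · refine h₂ (funext fun k => ?_)
    have := hσ k
    cases hk : σ k <;> simp_all [boolSign, le_of_lt]

theorem smi_eq_sign_prod {n : ℕ} (he : Even n) (v : Fin (n + 1) → (Fin n → ℝ)) :
    smi v = ((2 : ℝ) ^ (n + 1))⁻¹ * (2 * Real.sign (∏ k, signedMinor v k)) := by
  change _ * ∑ σ : Fin (n + 1) → Bool, sul (fun i => boolSign (σ i) • v i) = _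
  congr 1
  by_cases hv : ∀ k, signedMinor v k ≠ 0
  · rw [Finset.sum_congr rfl fun σ _ => sul_boolSign_smul he hv σ, Finset.sum_add_distrib]
    simp [two_mul]
  · push Not at hv
    obtain ⟨k, hk⟩ := hv
    rw [Finset.prod_eq_zero (Finset.mem_univ k) hk, Real.sign_zero, mul_zero]
    refine Finset.sum_eq_zero fun σ _ => sul_of_not fun h => ?_
    have h0 : signedMinor (fun i => boolSign (σ i) • v i) k = 0 := by
      rw [signedMinor_boolSign_smul, hk, mul_zero, mul_zero]
    exact h.elim (fun h => (h k).ne' h0) fun h => (h k).ne h0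

theorem smi_update_smul {n : ℕ} (he : Even n) (v : Fin (n + 1) → (Fin n → ℝ)) (j : Fin (n + 1))
    {c : ℝ} (hc : c ≠ 0) : smi (Function.update v j (c • v j)) = smi v := by
  have hu : Function.update v j (c • v j) = fun i => Function.update (1 : Fin (n + 1) → ℝ) j c i • v i := by
    ext i r
    by_cases h : i = j
    · subst h; simp
    · simp [h]
  have huc : ∏ i, Function.update (1 : Fin (n + 1) → ℝ) j c i = c := by
    simp [Finset.prod_update_of_mem]
  have hprod : (∏ k, signedMinor (fun i => Function.update (1 : Fin (n + 1) → ℝ) j c i • v i) k) *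
      c = c ^ n * (∏ k, signedMinor v k) * c := by
    conv_lhs => rw [← huc, ← Finset.prod_mul_distrib]
    simp only [signedMinor_smul_mul, huc, Finset.prod_mul_distrib, Finset.prod_const,
      Finset.card_univ, Fintype.card_fin, pow_succ, mul_right_comm _ c]
  rw [smi_eq_sign_prod he, smi_eq_sign_prod he, hu, mul_right_cancel₀ hc hprod, Real.sign_mul,
    Real.sign_of_pos (he.pow_pos hc), one_mul]

theorem smi_mulVec {n : ℕ} (he : Even n) (v : Fin (n + 1) → (Fin n → ℝ)) (g : GL (Fin n) ℝ) :
    smi (fun i => (g : Matrix (Fin n) (Fin n) ℝ) *ᵥ v i) = eps g * smi v := by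
  have hg : (g : Matrix (Fin n) (Fin n) ℝ).det ≠ 0 :=
    ((isUnit_iff_isUnit_det _).1 g.isUnit).ne_zero
  rw [smi_eq_sign_prod he, smi_eq_sign_prod he, eps]
  simp only [signedMinor_mulVec, Finset.prod_mul_distrib, Finset.prod_const, Finset.card_univ,
    Fintype.card_fin, pow_succ, Real.sign_mul, Real.sign_of_pos (he.pow_pos hg)]
  ring

/-- The alternating form `det (x, y, rows of v)`, whose values on the standard basis are up to sign
the maximal minors of the `n × (n+2)` matrix with columns `v`. -/
def pairForm {n : ℕ} (v : Fin (n + 2) → (Fin n → ℝ)) (x y : Fin (n + 2) → ℝ) : ℝ :=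
  det (of (vecCons x (vecCons y fun r k => v k r)))

theorem pairForm_single {n : ℕ} (v : Fin (n + 2) → (Fin n → ℝ)) (i : Fin (n + 2))
    (k : Fin (n + 1)) :
    pairForm v (Pi.single i 1) (Pi.single (i.succAbove k) 1) =
      (-1) ^ (i : ℕ) * signedMinor (v ∘ i.succAbove) k := by
  have h : (of (vecCons (Pi.single i 1) (vecCons (Pi.single (i.succAbove k) 1)
      fun r k => v k r))).submatrix Fin.succ i.succAbove =
      of (vecCons (Pi.single k (1 : ℝ)) fun r l => (v ∘ i.succAbove) l r) := by
    ext r l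
    refine Fin.cases ?_ (fun r => ?_) r
    · simp [Pi.single_apply]
    · simp
  rw [pairForm, det_succ_row_zero, Finset.sum_eq_single i, h, det_vecCons]
  · simp [Pi.single_apply]
  · intro j _ hj
    simp [hj]
  · simp

theorem pairForm_eq_sum {n : ℕ} (v : Fin (n + 2) → (Fin n → ℝ)) (x y : Fin (n + 2) → ℝ) :
    pairForm v x y = ∑ k, signedMinor (fun k => vecCons (y k) (v k)) k * x k := by
  rw [← det_vecCons, pairForm]
  congr 2
  ext r k
  refine Fin.cases rfl (fun r => Fin.cases rfl (fun r => rfl) r) r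

theorem pairForm_vecMul {n m : ℕ} (v : Fin (n + 2) → (Fin n → ℝ))
    (M : Matrix (Fin m) (Fin (n + 2)) ℝ) (c : Fin m → ℝ) (y : Fin (n + 2) → ℝ) :
    pairForm v (c ᵥ* M) y = ∑ r, c r * pairForm v (M.row r) y := by
  simp only [pairForm_eq_sum, vecMul, dotProduct, Finset.mul_sum, row_apply]
  rw [Finset.sum_comm]
  exact Finset.sum_congr rfl fun r _ => Finset.sum_congr rfl fun k _ => mul_left_comm _ _ _

theorem pairForm_self {n : ℕ} (v : Fin (n + 2) → (Fin n → ℝ)) (x : Fin (n + 2) → ℝ) :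
    pairForm v x x = 0 :=
  det_zero_of_row_eq (i := 0) (j := 1) (by simp) rfl

theorem pairForm_swap {n : ℕ} (v : Fin (n + 2) → (Fin n → ℝ)) (x y : Fin (n + 2) → ℝ) :
    pairForm v y x = -pairForm v x y := by
  have h := detRowAlternating.map_swap (vecCons x (vecCons y fun r k => v k r))
    (Fin.zero_ne_one (n := n))
  refine Eq.trans (congrArg det ?_) h
  ext r k
  refine Fin.cases ?_ (fun r => Fin.cases ?_ (fun r => ?_) r) r
  · simp
  · simp
  · rw [Function.comp_apply, Equiv.swap_apply_of_ne_of_ne (Fin.succ_ne_zero _)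
      (by simp [Fin.ext_iff])]
    rfl

theorem pairForm_row_left {n : ℕ} (v : Fin (n + 2) → (Fin n → ℝ)) (r : Fin n)
    (y : Fin (n + 2) → ℝ) : pairForm v (fun k => v k r) y = 0 :=
  det_zero_of_row_eq (i := 0) (j := r.succ.succ) (Fin.succ_ne_zero _).symm rfl

theorem pairForm_eq_mul_sub {n : ℕ} (v : Fin (n + 2) → (Fin n → ℝ)) {p q : Fin (n + 2) → ℝ}
    (h : pairForm v p q ≠ 0) :
    ∃ a b : (Fin (n + 2) → ℝ) → ℝ, ∀ x y,
      pairForm v x y = pairForm v p q * (a x * b y - a y * b x) := by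
  set M : Matrix (Fin (n + 2)) (Fin (n + 2)) ℝ := of (vecCons p (vecCons q fun r k => v k r))
  have key : ∀ x y, pairForm v x y =
      (x ᵥ* M⁻¹) 0 * pairForm v p y + (x ᵥ* M⁻¹) 1 * pairForm v q y := fun x y => by
    have hx : x ᵥ* M⁻¹ ᵥ* M = x := by
      rw [vecMul_vecMul, nonsing_inv_mul M (isUnit_iff_ne_zero.2 h), vecMul_one]
    have hr : ∀ r : Fin n, pairForm v (M.row r.succ.succ) y = 0 := fun r => pairForm_row_left v r y
    conv_lhs => rw [← hx]
    rw [pairForm_vecMul, Fin.sum_univ_succ, Fin.sum_univ_succ]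
    simp only [hr, mul_zero, Finset.sum_const_zero, add_zero]
    rfl
  refine ⟨fun x => (x ᵥ* M⁻¹) 0, fun x => (x ᵥ* M⁻¹) 1, fun x y => ?_⟩
  rw [key x y, pairForm_swap v y p, pairForm_swap v y q, key y p, key y q, pairForm_self,
    pairForm_self, pairForm_swap v p q]
  ring

theorem StrictMono.sign_prod_sub {m : ℕ} {t : Fin m → ℝ} (ht : StrictMono t) (i : Fin m) :
    Real.sign (∏ j ∈ Finset.univ.erase i, (t j - t i)) = (-1) ^ (i : ℕ) := by
  have h : ∀ j ∈ Finset.univ.erase i, Real.sign (t j - t i) = if j < i then -1 else 1 := by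
    intro j hj
    split_ifs with hji
    · exact Real.sign_of_neg (sub_neg.2 (ht hji))
    · exact Real.sign_of_pos (sub_pos.2 (ht (lt_of_le_of_ne (not_lt.1 hji)
        (Finset.ne_of_mem_erase hj).symm)))
  rw [Real.sign_prod, Finset.prod_congr rfl h, Finset.prod_erase _ (by simp), Finset.prod_ite]
  simp [Finset.filter_gt_eq_Iio]

theorem sum_sign_prod_sub_eq_zero {m : ℕ} (hm : Even m) {t : Fin m → ℝ}
    (ht : Function.Injective t) :
    ∑ i, Real.sign (∏ j ∈ Finset.univ.erase i, (t j - t i)) = 0 := by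
  have hs : StrictMono (t ∘ Tuple.sort t) :=
    (Tuple.monotone_sort t).strictMono_of_injective (ht.comp (Tuple.sort t).injective)
  rw [← Equiv.sum_comp (Tuple.sort t)]
  have h : ∀ i, ∏ j ∈ Finset.univ.erase (Tuple.sort t i), (t j - t (Tuple.sort t i)) =
      ∏ j ∈ Finset.univ.erase i, ((t ∘ Tuple.sort t) j - (t ∘ Tuple.sort t) i) := fun i =>
    (Finset.prod_equiv (Tuple.sort t) (by simp) (by simp)).symm
  simp only [h, hs.sign_prod_sub]
  rw [Fin.sum_univ_eq_sum_range (fun i => (-1 : ℝ) ^ i), neg_one_geom_sum, if_pos hm]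

theorem exists_forall_add_mul_ne_zero {ι : Type*} [Finite ι] {a b : ι → ℝ}
    (h : ∀ i, a i ≠ 0 ∨ b i ≠ 0) : ∃ s : ℝ, ∀ i, a i + s * b i ≠ 0 := by
  obtain ⟨s, hs⟩ := (Set.finite_range fun i => -a i / b i).exists_notMem
  refine ⟨s, fun i hi => ?_⟩
  by_cases hb : b i = 0
  · simp [hb] at hi
    exact (h i).elim (· hi) (· hb)
  · exact hs ⟨i, by field_simp; linarith⟩

/-- The projective version of `sum_sign_prod_sub_eq_zero`: the `(a i, b i)` are pairwise independent
vectors in the plane. -/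
theorem sum_sign_prod_mul_sub_eq_zero {m : ℕ} (hm : Even m) {a b : Fin m → ℝ} {d : ℝ}
    (h : ∀ i j, i ≠ j → d * (a i * b j - a j * b i) ≠ 0) :
    ∑ i, Real.sign (∏ j ∈ Finset.univ.erase i, (d * (a i * b j - a j * b i))) = 0 := by
  have hab : ∀ i, a i ≠ 0 ∨ b i ≠ 0 := fun i => by
    have : Nontrivial (Fin m) := by
      rw [Fin.nontrivial_iff_two_le]
      have := i.pos
      obtain ⟨k, rfl⟩ := hm
      omega
    obtain ⟨j, hj⟩ := exists_ne i
    by_contra! hi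
    exact h i j hj.symm (by simp [hi.1, hi.2])
  obtain ⟨s, hs⟩ := exists_forall_add_mul_ne_zero hab
  set u : Fin m → ℝ := fun i => a i + s * b i
  have hu : ∀ i, u i ≠ 0 := hs
  have hsub : ∀ i j, a i * b j - a j * b i = u i * u j * (b j / u j - b i / u i) := fun i j => by
    have h₁ : u i * u j * (b j / u j - b i / u i) = u i * b j - u j * b i := by
      field_simp [hu i, hu j]
    rw [h₁]
    ring
  have ht : Function.Injective fun i => b i / u i := fun i j hij => by
    by_contra hne
    exact h i j hne (by rw [hsub, sub_eq_zero.2 (Eq.symm hij), mul_zero, mul_zero])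
  have hprod : ∀ i, ∏ j ∈ Finset.univ.erase i, (d * (a i * b j - a j * b i)) =
      d ^ (m - 1) * (u i ^ (m - 2) * ∏ j, u j) *
        ∏ j ∈ Finset.univ.erase i, (b j / u j - b i / u i) := fun i => by
    have hm2 : m - 1 = m - 2 + 1 := by
      have := i.pos
      obtain ⟨k, rfl⟩ := hm
      omega
    simp only [hsub, Finset.prod_mul_distrib, Finset.prod_const,
      Finset.card_erase_of_mem (Finset.mem_univ i), Finset.card_univ, Fintype.card_fin]
    rw [← Finset.mul_prod_erase Finset.univ u (Finset.mem_univ i), hm2]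
    ring
  have heven : Even (m - 2) := hm.tsub even_two
  simp only [hprod, Real.sign_mul, Real.sign_of_pos (heven.pow_pos (hu _)), one_mul]
  rw [← Finset.mul_sum, sum_sign_prod_sub_eq_zero hm ht, mul_zero]

theorem HerSpan.signedMinor_ne_zero {n : ℕ} {v : Fin (n + 2) → (Fin n → ℝ)} (hv : HerSpan v)
    (i : Fin (n + 2)) (k : Fin (n + 1)) : signedMinor (v ∘ i.succAbove) k ≠ 0 := by
  have hinj : Function.Injective (i.succAbove ∘ k.succAbove) :=
    Fin.succAbove_right_injective.comp Fin.succAbove_right_injective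
  have hspan := hv (Finset.univ.image (i.succAbove ∘ k.succAbove))
    (by rw [Finset.card_image_of_injective _ hinj]; simp)
  rw [Finset.coe_image, Finset.coe_univ, Set.image_univ, ← Set.range_comp] at hspan
  have hli := linearIndependent_of_top_le_span_of_card_eq_finrank hspan.ge (by simp)
  have hdet : det (of fun r j => v (i.succAbove (k.succAbove j)) r) ≠ 0 :=
    ((isUnit_iff_isUnit_det _).1 (linearIndependent_cols_iff_isUnit.1 hli)).ne_zero
  exact mul_ne_zero (pow_ne_zero _ (by norm_num)) hdet

theorem sum_neg_one_pow_mul_smi {n : ℕ} (he : Even n) {v : Fin (n + 2) → (Fin n → ℝ)}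
    (hv : HerSpan v) :
    ∑ i : Fin (n + 2), (-1 : ℝ) ^ (i : ℕ) * smi (v ∘ i.succAbove) = 0 := by
  set e : Fin (n + 2) → Fin (n + 2) → ℝ := fun i => Pi.single i 1
  have hne : ∀ i j, i ≠ j → pairForm v (e i) (e j) ≠ 0 := fun i j hij => by
    obtain ⟨k, rfl⟩ := Fin.exists_succAbove_eq hij.symm
    rw [pairForm_single]
    exact mul_ne_zero (pow_ne_zero _ (by norm_num)) (hv.signedMinor_ne_zero i k)
  have hprod : ∀ i : Fin (n + 2), (-1 : ℝ) ^ (i : ℕ) * Real.sign (∏ k, signedMinor (v ∘ i.succAbove) k) =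
      Real.sign (∏ j ∈ Finset.univ.erase i, pairForm v (e i) (e j)) := fun i => by
    have herase : Finset.univ.erase i = Finset.univ.map i.succAboveEmb := by
      ext j
      simp [Fin.exists_succAbove_eq_iff]
    have hsign : Real.sign ((-1) ^ (i : ℕ)) = (-1) ^ (i : ℕ) := by
      rcases neg_one_pow_eq_or ℝ (i : ℕ) with h | h <;> simp [h, Real.sign_neg]
    rw [herase, Finset.prod_map]
    simp only [Fin.coe_succAboveEmb, e, pairForm_single, Finset.prod_mul_distrib,
      Finset.prod_const, Finset.card_univ, Fintype.card_fin]
    rw [Real.sign_mul, ← pow_mul, mul_comm (i : ℕ), pow_mul, he.add_one.neg_one_pow, hsign]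
  obtain ⟨a, b, hab⟩ := pairForm_eq_mul_sub v (hne 0 1 Fin.zero_ne_one)
  have hzero := sum_sign_prod_mul_sub_eq_zero (he.add even_two)
    (d := pairForm v (e 0) (e 1)) (a := fun i => a (e i)) (b := fun i => b (e i)) fun i j hij => by
      rw [← hab]
      exact hne i j hij
  simp only [← hab, ← hprod] at hzero
  calc _ = ((2 : ℝ) ^ (n + 1))⁻¹ * 2 * ∑ i : Fin (n + 2),
      (-1 : ℝ) ^ (i : ℕ) * Real.sign (∏ k, signedMinor (v ∘ i.succAbove) k) := by
        rw [Finset.mul_sum]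
        refine Finset.sum_congr rfl fun i _ => ?_
        rw [smi_eq_sign_prod he]
        ring
    _ = 0 := by rw [hzero, mul_zero]

/-- (i) `smi` is invariant under scaling any single entry by a nonzero
scalar (hence descends to `(ℙ(ℝⁿ))^{n+1}`); (ii) `smi` is `GL_n(ℝ)`-equivariant with
values in the sign module `ℝ_ε`; (iii) the coboundary of `smi` vanishes on hereditarily
spanning `(n+2)`-tuples. -/
theorem stmt18 (n : ℕ) (hn : 0 < n) (he : Even n) :
    (∀ (v : Fin (n + 1) → (Fin n → ℝ)) (j : Fin (n + 1)) (lam : ℝ), lam ≠ 0 →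
      smi (Function.update v j (lam • v j)) = smi v) ∧
    (∀ (v : Fin (n + 1) → (Fin n → ℝ)) (g : GL (Fin n) ℝ),
      smi (fun i => (g : Matrix (Fin n) (Fin n) ℝ) *ᵥ v i) = eps g * smi v) ∧
    (∀ v : Fin (n + 2) → (Fin n → ℝ), HerSpan v →
      ∑ i : Fin (n + 2), (-1 : ℝ) ^ (i : ℕ) * smi (v ∘ i.succAbove) = 0) := by
  exact ⟨fun v j _ hlam => smi_update_smul he v j hlam, smi_mulVec he,
    fun _ hv => sum_neg_one_pow_mul_smi he hv⟩

end
end
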